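/- Let R be a commutative Noetherian ring, 𝔞 an ideal of R, 𝒮 a Serre subcategory of the category of R-modules, and 𝒞 a class of R-modules satisfying: (1) 𝒮 ⊆ 𝒞; (2) for each M ∈ 𝒞 the submodule (0 :_M 𝔞) belongs to 𝒮; (3) whenever 0 → M' → M → M'' → 0 is a short exact sequence of R-modules with M' and M in 𝒞, also M'' is in 𝒞. Let X^• : 0 → X^0 → X^1 → X^2 → ⋯ be a nonnegatively graded cochain complex of R-modules such that every X^i belongs to 𝒞 and such that for every i the ideal 𝔞 is contained in the radical of the annihilator of H^i(X^•). Then H^i(X^•) belongs to 𝒮 for all i. -/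

import Mathlib

universe u

/-- A Serre subcategory of the category of `R`-modules: a class of `R`-modules,
closed under isomorphism, submodules, quotient modules and extensions. -/
structure SerreClass (R : Type u) [CommRing R] : Type (u + 1) where
  mem : ∀ (M : Type u) [AddCommGroup M] [Module R M], Prop
  mem_of_linearEquiv :
    ∀ (M N : Type u) [AddCommGroup M] [Module R M] [AddCommGroup N] [Module R N],
      (M ≃ₗ[R] N) → mem M → mem N
  mem_submodule :
    ∀ (M : Type u) [AddCommGroup M] [Module R M] (N : Submodule R M), mem M → mem N
  mem_quotient :
    ∀ (M : Type u) [AddCommGroup M] [Module R M] (N : Submodule R M), mem M → mem (M ⧸ N)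
  mem_extension :
    ∀ (M : Type u) [AddCommGroup M] [Module R M] (N : Submodule R M),
      mem N → mem (M ⧸ N) → mem M

open CategoryTheory

namespace SerreClass

variable {R : Type u} [CommRing R] (𝒮 : SerreClass R)

lemma mem_of_injective {M N : Type u} [AddCommGroup M] [Module R M] [AddCommGroup N]
    [Module R N] (f : M →ₗ[R] N) (hf : Function.Injective f) (hN : 𝒮.mem N) : 𝒮.mem M :=
  𝒮.mem_of_linearEquiv _ _ (LinearEquiv.ofInjective f hf).symm (𝒮.mem_submodule N f.range hN)

lemma mem_of_ker {M N : Type u} [AddCommGroup M] [Module R M] [AddCommGroup N] [Module R N]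
    (f : M →ₗ[R] N) (hf : 𝒮.mem f.ker) (hN : 𝒮.mem N) : 𝒮.mem M :=
  𝒮.mem_extension M f.ker hf <|
    𝒮.mem_of_injective (f.ker.liftQ f le_rfl) (LinearMap.ker_eq_bot.mp <|
      Submodule.ker_liftQ_eq_bot _ _ _ le_rfl) hN

lemma mem_of_subsingleton {M N : Type u} [AddCommGroup M] [Module R M] [AddCommGroup N]
    [Module R N] [Subsingleton M] (hN : 𝒮.mem N) : 𝒮.mem M :=
  𝒮.mem_of_injective (0 : M →ₗ[R] N) (Function.injective_of_subsingleton _) hN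

lemma mem_pi {M : Type u} [AddCommGroup M] [Module R M] (hM : 𝒮.mem M) (n : ℕ) :
    𝒮.mem (Fin n → M) := by
  induction n with
  | zero => exact 𝒮.mem_of_subsingleton hM
  | succ n ih =>
    refine 𝒮.mem_of_ker (LinearMap.funLeft R M Fin.succ) ?_ ih
    refine 𝒮.mem_of_injective (LinearMap.proj 0 ∘ₗ Submodule.subtype _) ?_ hM
    rw [← LinearMap.ker_eq_bot, LinearMap.ker_eq_bot']
    rintro ⟨x, hx⟩ h0
    ext i
    exact Fin.cases h0 (fun j => congrFun hx j) i

lemma mem_torsionBySet_of_injective {M N : Type u} [AddCommGroup M] [Module R M]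
    [AddCommGroup N] [Module R N] (f : M →ₗ[R] N) (hf : Function.Injective f) (s : Set R)
    (hN : 𝒮.mem (Submodule.torsionBySet R N s)) : 𝒮.mem (Submodule.torsionBySet R M s) := by
  have h (x : M) (hx : x ∈ Submodule.torsionBySet R M s) :
      f x ∈ Submodule.torsionBySet R N s := by
    rw [Submodule.mem_torsionBySet_iff] at hx ⊢
    intro a
    rw [← map_smul, hx a, map_zero]
  refine 𝒮.mem_of_injective (f.restrict h) (fun x y hxy => Subtype.ext (hf ?_)) hN
  exact Subtype.ext_iff.mp hxy

/-- If a power of a finitely generated ideal `𝔞` kills `M` and the elements of `M` killed by `𝔞`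
form a module in `𝒮`, then `M` is in `𝒮`. -/
lemma mem_of_pow_le_annihilator {𝔞 : Ideal R} (h𝔞 : 𝔞.FG) (n : ℕ) :
    ∀ (M : Type u) [AddCommGroup M] [Module R M], 𝔞 ^ n ≤ Module.annihilator R M →
      𝒮.mem (Submodule.torsionBySet R M (𝔞 : Set R)) → 𝒮.mem M := by
  induction n with
  | zero =>
    intro M _ _ hM ht
    have : Subsingleton M := by
      rw [← Module.annihilator_eq_top_iff (R := R)]
      simpa using hM
    exact 𝒮.mem_of_subsingleton ht
  | succ n ih =>
    intro M _ _ hM ht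
    have h𝔞M : 𝒮.mem (𝔞 • ⊤ : Submodule R M) := by
      refine ih _ (fun r hr => ?_) ?_
      · rw [Submodule.mem_annihilator]
        intro x hx
        induction hx using Submodule.smul_induction_on' with
        | smul a ha m _ =>
          rw [← mul_smul]
          exact Module.mem_annihilator.mp (hM (pow_succ 𝔞 n ▸ Ideal.mul_mem_mul hr ha)) m
        | add x _ y _ hx hy => rw [smul_add, hx, hy, add_zero]
      · exact 𝒮.mem_torsionBySet_of_injective _ (Submodule.subtype_injective _) _ ht
    obtain ⟨k, g, hg⟩ := Submodule.fg_iff_exists_fin_generating_family.mp h𝔞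
    have hg_mem (i : Fin k) : g i ∈ 𝔞 := hg ▸ Submodule.subset_span ⟨i, rfl⟩
    let φ : M →ₗ[R] Fin k → (𝔞 • ⊤ : Submodule R M) := LinearMap.pi fun i =>
      (LinearMap.lsmul R M (g i)).codRestrict _
        fun m => Submodule.smul_mem_smul (hg_mem i) Submodule.mem_top
    have hφ : φ.ker ≤ Submodule.torsionBySet R M (𝔞 : Set R) := by
      intro m hm
      rw [← hg, ← Ideal.span, ← Submodule.torsionBySet_eq_torsionBySet_span,
        Submodule.mem_torsionBySet_iff]
      rintro ⟨_, i, rfl⟩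
      exact congrArg Subtype.val (congrFun hm i)
    exact 𝒮.mem_of_ker φ
      (𝒮.mem_of_injective (Submodule.inclusion hφ) (Submodule.inclusion_injective hφ) ht)
      (𝒮.mem_pi h𝔞M k)

lemma mem_of_le_radical_annihilator [IsNoetherianRing R] {𝔞 : Ideal R} (M : Type u)
    [AddCommGroup M] [Module R M] (hM : 𝔞 ≤ (Module.annihilator R M).radical)
    (ht : 𝒮.mem (Submodule.torsionBySet R M (𝔞 : Set R))) : 𝒮.mem M := by
  have h𝔞 : 𝔞.FG := IsNoetherian.noetherian 𝔞
  obtain ⟨n, hn⟩ := Ideal.exists_pow_le_of_le_radical_of_fg hM h𝔞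
  exact 𝒮.mem_of_pow_le_annihilator h𝔞 n M hn ht

end SerreClass

/-- The inductive step: if the boundaries in the middle of a short complex belong to `𝒞`, then its
homology belongs to `𝒮` and the boundaries on the right belong to `𝒞`. -/
lemma homology_mem_serre_and_range_mem
    {R : Type u} [CommRing R] [IsNoetherianRing R] {𝔞 : Ideal R} (𝒮 : SerreClass R)
    (𝒞 : ∀ (M : Type u) [AddCommGroup M] [Module R M], Prop)
    (h1 : ∀ (M : Type u) [AddCommGroup M] [Module R M], 𝒮.mem M → 𝒞 M)
    (h2 : ∀ (M : Type u) [AddCommGroup M] [Module R M],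
      𝒞 M → 𝒮.mem (Submodule.torsionBySet R M (𝔞 : Set R)))
    (h3 : ∀ (A B C : Type u) [AddCommGroup A] [Module R A] [AddCommGroup B] [Module R B]
      [AddCommGroup C] [Module R C] (f : A →ₗ[R] B) (g : B →ₗ[R] C),
      Function.Injective f → Function.Surjective g → Function.Exact f g → 𝒞 A → 𝒞 B → 𝒞 C)
    (S : ShortComplex (ModuleCat.{u} R)) (hS : 𝒞 S.X₂) (hf : 𝒞 S.f.hom.range)
    (hann : 𝔞 ≤ (Module.annihilator R S.homology).radical) :
    𝒮.mem S.homology ∧ 𝒞 S.g.hom.range := by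
  have hp : Function.Surjective S.pOpcycles.hom :=
    (ModuleCat.epi_iff_surjective _).mp inferInstance
  have hι : Function.Injective S.homologyι.hom :=
    (ModuleCat.mono_iff_injective _).mp inferInstance
  have hfp : Function.Exact S.f.hom S.pOpcycles.hom :=
    (ShortComplex.ShortExact.moduleCat_exact_iff_function_exact
      (ShortComplex.mk _ _ S.f_pOpcycles)).mp
      (ShortComplex.exact_of_g_is_cokernel _ S.opcyclesIsCokernel)
  have hιg : Function.Exact S.homologyι.hom S.fromOpcycles.hom :=
    (ShortComplex.ShortExact.moduleCat_exact_iff_function_exact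
      (ShortComplex.mk _ _ S.homologyι_comp_fromOpcycles)).mp
      (ShortComplex.exact_of_f_is_kernel _ S.homologyIsKernel)
  have hpg (x : S.X₂) : S.fromOpcycles.hom (S.pOpcycles.hom x) = S.g.hom x :=
    LinearMap.congr_fun (congrArg ModuleCat.Hom.hom S.p_fromOpcycles) x
  have hO : 𝒞 S.opcycles :=
    h3 _ _ _ S.f.hom.range.subtype S.pOpcycles.hom Subtype.val_injective hp
      (fun x => by rw [hfp x]; simp) hf hS
  have hH : 𝒮.mem S.homology :=
    𝒮.mem_of_le_radical_annihilator _ hann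
      (𝒮.mem_torsionBySet_of_injective S.homologyι.hom hι _ (h2 _ hO))
  have hmem (y : S.opcycles) : S.fromOpcycles.hom y ∈ S.g.hom.range := by
    obtain ⟨x, rfl⟩ := hp y
    exact ⟨x, (hpg x).symm⟩
  refine ⟨hH, h3 _ _ _ S.homologyι.hom (S.fromOpcycles.hom.codRestrict _ hmem) hι ?_ ?_
    (h1 _ hH) hO⟩
  · rintro ⟨_, x, rfl⟩
    exact ⟨S.pOpcycles.hom x, Subtype.ext (hpg x)⟩
  · intro y
    rw [← hιg y]
    exact Subtype.ext_iff

/-- Lemma 2.3: for a cochain complex `0 → X^0 → X^1 → ⋯` with all entries in `𝒞` and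
`𝔞 ⊆ √(Ann H^i)` for all `i`, all cohomology modules lie in `𝒮`. -/
theorem cohomology_mem_serre_of_cochainComplex
    (R : Type u) [CommRing R] [IsNoetherianRing R] (𝔞 : Ideal R) (𝒮 : SerreClass R)
    (𝒞 : ∀ (M : Type u) [AddCommGroup M] [Module R M], Prop)
    (h1 : ∀ (M : Type u) [AddCommGroup M] [Module R M], 𝒮.mem M → 𝒞 M)
    (h2 : ∀ (M : Type u) [AddCommGroup M] [Module R M],
      𝒞 M → 𝒮.mem (Submodule.torsionBySet R M (𝔞 : Set R)))
    (h3 : ∀ (A B C : Type u) [AddCommGroup A] [Module R A] [AddCommGroup B] [Module R B]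
      [AddCommGroup C] [Module R C] (f : A →ₗ[R] B) (g : B →ₗ[R] C),
      Function.Injective f → Function.Surjective g → Function.Exact f g → 𝒞 A → 𝒞 B → 𝒞 C)
    (X : CochainComplex (ModuleCat.{u} R) ℕ)
    (hX : ∀ i : ℕ, 𝒞 (X.X i))
    (hann : ∀ i : ℕ, 𝔞 ≤ (Module.annihilator R (X.homology i)).radical) :
    ∀ i : ℕ, 𝒮.mem (X.homology i) := by
  have step (i : ℕ) (hi : 𝒞 (X.sc i).f.hom.range) :=
    homology_mem_serre_and_range_mem 𝒮 𝒞 h1 h2 h3 (X.sc i) (hX i) hi (hann i)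
  suffices H : ∀ i, 𝒞 (X.sc i).f.hom.range from fun i => (step i (H i)).1
  intro i
  induction i with
  | zero =>
    have h0 : (X.sc 0).f = 0 := X.shape _ _ (by simp)
    have : Subsingleton (X.sc 0).f.hom.range := by
      rw [h0, ModuleCat.hom_zero, LinearMap.range_zero]
      infer_instance
    exact h1 _ (𝒮.mem_of_subsingleton (h2 _ (hX 0)))
  | succ i ih =>
    have transport {j k l : ℕ} (hj : j = k) (hl : l = i) (h : 𝒞 (X.d i j).hom.range) :
        𝒞 (X.d l k).hom.range := by
      subst hj hl
      exact h
    exact transport (CochainComplex.next ℕ i) (CochainComplex.prev_nat_succ i) (step i ih).2
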